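/- Let H_2 be the graph on vertices {u_1, u_2, s_1, s_2, s_3, s_4} where u_1 and u_2 are both adjacent to s_1, s_2, s_3, s_4, and s_1 s_2 and s_3 s_4 are edges (so {u_1, u_2, s_1, s_2} and {u_1, u_2, s_3, s_4} each induce K_4). With lists L(u_1) = {1,2}, L(u_2) = {1,2,3,4,5}, L(s_1) = L(s_2) = {1,2,3}, L(s_3) = L(s_4) = {1,2,4}, every proper L-colouring φ of H_2 satisfies φ(u_2) = 5. -/

import Mathlib

/-- The graph `H₂` on vertices `0 = u₁, 1 = u₂, 2 = s₁, 3 = s₂, 4 = s₃, 5 = s₄`: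
`{u₁, u₂, s₁, s₂}` and `{u₁, u₂, s₃, s₄}` each induce a `K₄`, with no other edges. -/
def H2 : SimpleGraph (Fin 6) :=
  SimpleGraph.fromRel (fun i j =>
    (i ∈ ({0, 1, 2, 3} : Finset (Fin 6)) ∧ j ∈ ({0, 1, 2, 3} : Finset (Fin 6))) ∨
    (i ∈ ({0, 1, 4, 5} : Finset (Fin 6)) ∧ j ∈ ({0, 1, 4, 5} : Finset (Fin 6))))

/-- The list assignment: `L(u₁) = {1,2}`, `L(u₂) = {1,…,5}`, `L(s₁) = L(s₂) = {1,2,3}`,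
`L(s₃) = L(s₄) = {1,2,4}`. -/
def L2 : Fin 6 → Finset ℕ :=
  ![{1, 2}, {1, 2, 3, 4, 5}, {1, 2, 3}, {1, 2, 3}, {1, 2, 4}, {1, 2, 4}]

/-- Every proper `L`-colouring `φ` of `H₂` satisfies `φ(u₂) = 5`. -/
theorem stmt_3 (φ : Fin 6 → ℕ) (hmem : ∀ v, φ v ∈ L2 v)
    (hproper : ∀ u v, H2.Adj u v → φ u ≠ φ v) :
    φ 1 = 5 := by
  have m0 : φ 0 = 1 ∨ φ 0 = 2 := by simpa [L2] using hmem 0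
  have m1 : φ 1 = 1 ∨ φ 1 = 2 ∨ φ 1 = 3 ∨ φ 1 = 4 ∨ φ 1 = 5 := by simpa [L2] using hmem 1
  have m2 : φ 2 = 1 ∨ φ 2 = 2 ∨ φ 2 = 3 := by simpa [L2] using hmem 2
  have m3 : φ 3 = 1 ∨ φ 3 = 2 ∨ φ 3 = 3 := by simpa [L2] using hmem 3
  have m4 : φ 4 = 1 ∨ φ 4 = 2 ∨ φ 4 = 4 := by simpa [L2] using hmem 4
  have m5 : φ 5 = 1 ∨ φ 5 = 2 ∨ φ 5 = 4 := by simpa [L2] using hmem 5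
  have h01 : φ 0 ≠ φ 1 := hproper 0 1 (by simp [H2])
  have h02 : φ 0 ≠ φ 2 := hproper 0 2 (by simp [H2])
  have h03 : φ 0 ≠ φ 3 := hproper 0 3 (by simp [H2])
  have h04 : φ 0 ≠ φ 4 := hproper 0 4 (by simp [H2])
  have h05 : φ 0 ≠ φ 5 := hproper 0 5 (by simp [H2])
  have h12 : φ 1 ≠ φ 2 := hproper 1 2 (by simp [H2])
  have h13 : φ 1 ≠ φ 3 := hproper 1 3 (by simp [H2])
  have h14 : φ 1 ≠ φ 4 := hproper 1 4 (by simp [H2])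
  have h15 : φ 1 ≠ φ 5 := hproper 1 5 (by simp [H2])
  have h23 : φ 2 ≠ φ 3 := hproper 2 3 (by simp [H2])
  have h45 : φ 4 ≠ φ 5 := hproper 4 5 (by simp [H2])
  clear hmem hproper
  omega
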